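/- For every n ≥ 0, the abelian complexity function ρ of the ordinary paperfolding word satisfies ρ(16n+13) = ρ(2n+1) + 2. -/

import Mathlib

/-- The ordinary paperfolding word over `{0,1}`, indexed from 1:
writing `n = n' * 2^k` with `n'` odd, `pf n = 0` if `n' ≡ 1 (mod 4)`
and `pf n = 1` if `n' ≡ 3 (mod 4)`.  (The value at `0` is irrelevant.) -/
def pf (n : ℕ) : ℕ := if (n / 2 ^ (n.factorization 2)) % 4 = 1 then 0 else 1

/-- The factor `f_i f_{i+1} ⋯ f_{i+n-1}` of the paperfolding word,
of length `n`, starting at position `i`. -/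
def pfFactor (i n : ℕ) : List ℕ := (List.range n).map (fun j => pf (i + j))

/-- `w` is a factor of the ordinary paperfolding word. -/
def IsPFFactor (w : List ℕ) : Prop := ∃ i : ℕ, 1 ≤ i ∧ w = pfFactor i w.length

/-- The abelian complexity function of the ordinary paperfolding word:
the number of abelian equivalence classes of factors of length `n`,
where the class of a factor `w` is determined by the pair
`(|w|_0, |w|_1)` of numbers of occurrences of `0` and `1` in `w`. -/
noncomputable def ρ (n : ℕ) : ℕ :=
  {p : ℕ × ℕ | ∃ i : ℕ, 1 ≤ i ∧
    p = ((pfFactor i n).count 0, (pfFactor i n).count 1)}.ncard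

/-- `Δ w = |w|_0 - |w|_1`. -/
def Δ (w : List ℕ) : ℤ := (w.count 0 : ℤ) - (w.count 1 : ℤ)

/-- `M n` is the maximum of `Δ w` over all factors `w` of the
paperfolding word of length `n`. -/
noncomputable def M (n : ℕ) : ℤ :=
  sSup {d : ℤ | ∃ i : ℕ, 1 ≤ i ∧ d = Δ (pfFactor i n)}

lemma pf_le_one (n : ℕ) : pf n ≤ 1 := by
  unfold pf; split_ifs <;> omega

lemma pf_two_mul (n : ℕ) (hn : 1 ≤ n) : pf (2 * n) = pf n := by
  have h : (2 * n).factorization 2 = n.factorization 2 + 1 := by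
    rw [Nat.factorization_mul (by norm_num) (by omega), Finsupp.add_apply,
      Nat.Prime.factorization_self Nat.prime_two, add_comm]
  unfold pf
  rw [h, pow_succ', Nat.mul_div_mul_left _ _ (by norm_num)]

lemma pf_of_odd (n : ℕ) (hn : n % 2 = 1) : pf n = if n % 4 = 1 then 0 else 1 := by
  have h : n.factorization 2 = 0 := Nat.factorization_eq_zero_of_not_dvd (by omega)
  simp [pf, h]

/-- The number of ones among the first `N` letters of the paperfolding word. -/
def pfOnes (N : ℕ) : ℕ := ∑ k ∈ Finset.range N, pf (k + 1)

lemma pfOnes_succ (N : ℕ) : pfOnes (N + 1) = pfOnes N + pf (N + 1) :=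
  Finset.sum_range_succ _ _

lemma pf_eight_mul_add (m : ℕ) :
    pf (8 * m + 1) = 0 ∧ pf (8 * m + 2) = 0 ∧ pf (8 * m + 3) = 1 ∧ pf (8 * m + 4) = m % 2 ∧
      pf (8 * m + 5) = 0 ∧ pf (8 * m + 6) = 1 ∧ pf (8 * m + 7) = 1 ∧
      pf (8 * m + 8) = pf (m + 1) := by
  have h2 : pf (8 * m + 2) = pf (4 * m + 1) := by
    rw [← pf_two_mul (4 * m + 1) (by omega)]; ring_nf
  have h6 : pf (8 * m + 6) = pf (4 * m + 3) := by
    rw [← pf_two_mul (4 * m + 3) (by omega)]; ring_nf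
  have h4 : pf (8 * m + 4) = pf (2 * m + 1) := by
    rw [← pf_two_mul (2 * m + 1) (by omega), ← pf_two_mul (2 * (2 * m + 1)) (by omega)]
    ring_nf
  have h8 : pf (8 * m + 8) = pf (m + 1) := by
    rw [← pf_two_mul (m + 1) (by omega), ← pf_two_mul (2 * (m + 1)) (by omega),
      ← pf_two_mul (2 * (2 * (m + 1))) (by omega)]
    ring_nf
  rw [h2, h4, h6, h8, pf_of_odd (8 * m + 1) (by omega), pf_of_odd (4 * m + 1) (by omega),
    pf_of_odd (8 * m + 3) (by omega), pf_of_odd (2 * m + 1) (by omega),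
    pf_of_odd (8 * m + 5) (by omega), pf_of_odd (4 * m + 3) (by omega),
    pf_of_odd (8 * m + 7) (by omega)]
  refine ⟨?_, ?_, ?_, ?_, ?_, ?_, ?_, rfl⟩ <;> split_ifs <;> omega

lemma pfOnes_eight_mul (m : ℕ) : pfOnes (8 * m) = pfOnes m + 3 * m + m / 2 := by
  induction m with
  | zero => simp [pfOnes]
  | succ m ih =>
    obtain ⟨h1, h2, h3, h4, h5, h6, h7, h8⟩ := pf_eight_mul_add m
    have h : pfOnes (8 * (m + 1)) = pfOnes (8 * m) + pf (8 * m + 1) + pf (8 * m + 2) +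
        pf (8 * m + 3) + pf (8 * m + 4) + pf (8 * m + 5) + pf (8 * m + 6) + pf (8 * m + 7) +
        pf (8 * m + 8) := by
      rw [show 8 * (m + 1) = 8 * m + 7 + 1 by ring]
      simp only [pfOnes_succ]
    rw [h, pfOnes_succ]
    omega

lemma pfOnes_eight_mul_add (m : ℕ) :
    pfOnes (8 * m + 1) = pfOnes m + 3 * m + m / 2 ∧
    pfOnes (8 * m + 2) = pfOnes m + 3 * m + m / 2 ∧
    pfOnes (8 * m + 3) = pfOnes m + 3 * m + m / 2 + 1 ∧
    pfOnes (8 * m + 4) = pfOnes m + 3 * m + m / 2 + 1 + m % 2 ∧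
    pfOnes (8 * m + 5) = pfOnes m + 3 * m + m / 2 + 1 + m % 2 ∧
    pfOnes (8 * m + 6) = pfOnes m + 3 * m + m / 2 + 2 + m % 2 ∧
    pfOnes (8 * m + 7) = pfOnes m + 3 * m + m / 2 + 3 + m % 2 := by
  obtain ⟨h1, h2, h3, h4, h5, h6, h7, -⟩ := pf_eight_mul_add m
  have h0 := pfOnes_eight_mul m
  have s1 := pfOnes_succ (8 * m)
  have s2 := pfOnes_succ (8 * m + 1)
  have s3 := pfOnes_succ (8 * m + 2)
  have s4 := pfOnes_succ (8 * m + 3)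
  have s5 := pfOnes_succ (8 * m + 4)
  have s6 := pfOnes_succ (8 * m + 5)
  have s7 := pfOnes_succ (8 * m + 6)
  simp only [add_assoc, Nat.reduceAdd] at *
  omega

/-- The number of ones in the factor of length `n` starting at position `a + 1`. -/
def pfWindow (n a : ℕ) : ℕ := ∑ j ∈ Finset.range n, pf (a + 1 + j)

lemma pfOnes_add (a n : ℕ) : pfOnes (a + n) = pfOnes a + pfWindow n a := by
  rw [pfOnes, Finset.sum_range_add, ← pfOnes, pfWindow]
  simp only [add_right_comm]

lemma pfWindow_step (n a : ℕ) :
    pfWindow n (a + 1) ≤ pfWindow n a + 1 ∧ pfWindow n a ≤ pfWindow n (a + 1) + 1 := by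
  have h1 := pfOnes_add a n
  have h2 := pfOnes_add (a + 1) n
  rw [add_right_comm, pfOnes_succ, pfOnes_succ] at h2
  have h3 := pf_le_one (a + 1)
  have h4 := pf_le_one (a + n + 1)
  omega

lemma pfWindow_le (n a : ℕ) : pfWindow n a ≤ n := by
  simpa [pfWindow] using Finset.sum_le_card_nsmul (Finset.range n) (fun j => pf (a + 1 + j)) 1
    (fun j _ => pf_le_one _)

lemma pfFactor_count (a n : ℕ) :
    (pfFactor (a + 1) n).count 1 = pfWindow n a ∧
      (pfFactor (a + 1) n).count 0 = n - pfWindow n a := by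
  suffices h : (pfFactor (a + 1) n).count 1 = pfWindow n a ∧
      (pfFactor (a + 1) n).count 0 + pfWindow n a = n by omega
  induction n with
  | zero => simp [pfFactor, pfWindow]
  | succ n ih =>
    have hs : pfFactor (a + 1) (n + 1) = pfFactor (a + 1) n ++ [pf (a + 1 + n)] := by
      simp [pfFactor, List.range_succ]
    have hw : pfWindow (n + 1) a = pfWindow n a + pf (a + 1 + n) := Finset.sum_range_succ _ _
    rw [hs, hw, List.count_append, List.count_append]
    have := pf_le_one (a + 1 + n)
    obtain h | h : pf (a + 1 + n) = 0 ∨ pf (a + 1 + n) = 1 := by omega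
    all_goals simp [h]; omega

lemma rho_eq_ncard_range (n : ℕ) : ρ n = (Set.range (pfWindow n)).ncard := by
  have hinj : Function.Injective (fun c : ℕ => (n - c, c)) := fun x y h => (Prod.mk.inj h).2
  rw [← Set.ncard_image_of_injective _ hinj, ρ]
  congr 1
  ext p
  simp only [Set.mem_ofPred_eq, Set.mem_image, Set.mem_range, exists_exists_eq_and]
  constructor
  · rintro ⟨i, hi, rfl⟩
    obtain ⟨a, rfl⟩ := Nat.exists_eq_add_of_le' hi
    exact ⟨a, by rw [(pfFactor_count a n).1, (pfFactor_count a n).2]⟩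
  · rintro ⟨a, rfl⟩
    exact ⟨a + 1, by omega, by rw [(pfFactor_count a n).1, (pfFactor_count a n).2]⟩

/-- Discrete intermediate value property for sequences with steps of size at most one. -/
lemma exists_eq_of_step_le_one {h : ℕ → ℕ}
    (hstep : ∀ a, h (a + 1) ≤ h a + 1 ∧ h a ≤ h (a + 1) + 1) (a d z : ℕ)
    (hz : h a ≤ z ∧ z ≤ h (a + d) ∨ h (a + d) ≤ z ∧ z ≤ h a) : ∃ c, h c = z := by
  induction d with
  | zero => exact ⟨a, by simp only [add_zero] at hz; omega⟩
  | succ d ih =>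
    by_cases hend : h (a + (d + 1)) = z
    · exact ⟨_, hend⟩
    · have := hstep (a + d)
      rw [add_assoc] at this
      exact ih (by omega)

lemma range_eq_Icc_of_step_le_one {h : ℕ → ℕ}
    (hstep : ∀ a, h (a + 1) ≤ h a + 1 ∧ h a ≤ h (a + 1) + 1) {B : ℕ} (hB : ∀ a, h a ≤ B) :
    ∃ lo hi, lo ≤ hi ∧ Set.range h = Set.Icc lo hi := by
  have hne : (Set.range h).Nonempty := Set.range_nonempty h
  have hbdd : BddAbove (Set.range h) := ⟨B, by rintro _ ⟨a, rfl⟩; exact hB a⟩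
  obtain ⟨a, ha⟩ := Nat.sInf_mem hne
  obtain ⟨b, hb⟩ := Nat.sSup_mem hne hbdd
  refine ⟨sInf (Set.range h), sSup (Set.range h), ?_, Set.Subset.antisymm ?_ ?_⟩
  · rw [← ha]; exact le_csSup hbdd ⟨a, rfl⟩
  · rintro _ ⟨c, rfl⟩
    exact ⟨Nat.sInf_le ⟨c, rfl⟩, le_csSup hbdd ⟨c, rfl⟩⟩
  · rintro z ⟨hlo, hhi⟩
    rw [← ha] at hlo
    rw [← hb] at hhi
    obtain hab | hab := le_total a b
    · obtain ⟨d, rfl⟩ := Nat.exists_eq_add_of_le hab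
      exact exists_eq_of_step_le_one hstep a d z (Or.inl ⟨hlo, hhi⟩)
    · obtain ⟨d, rfl⟩ := Nat.exists_eq_add_of_le hab
      exact exists_eq_of_step_le_one hstep b d z (Or.inr ⟨hlo, hhi⟩)

lemma pfWindow_eight_mul (n m : ℕ) :
    pfWindow (16 * n + 13) (8 * m) = pfWindow (2 * n + 1) m + (7 * n + 5) ∧
    pfWindow (16 * n + 13) (8 * m + 1) = pfWindow (2 * n + 1) m + (7 * n + 6) ∧
    pfWindow (16 * n + 13) (8 * m + 2) = pfWindow (2 * n + 1) m + (7 * n + 7) := by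
  have e0 := pfOnes_add (8 * m) (16 * n + 13)
  have e1 := pfOnes_add (8 * m + 1) (16 * n + 13)
  have e2 := pfOnes_add (8 * m + 2) (16 * n + 13)
  rw [show 8 * m + (16 * n + 13) = 8 * (m + (2 * n + 1)) + 5 by ring] at e0
  rw [show 8 * m + 1 + (16 * n + 13) = 8 * (m + (2 * n + 1)) + 6 by ring] at e1
  rw [show 8 * m + 2 + (16 * n + 13) = 8 * (m + (2 * n + 1)) + 7 by ring] at e2
  have h := pfOnes_add m (2 * n + 1)
  have hm := pfOnes_eight_mul_add m
  have hm0 := pfOnes_eight_mul m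
  have hk := pfOnes_eight_mul_add (m + (2 * n + 1))
  omega

lemma pfWindow_eight_mul_add (n m r : ℕ) (h3 : 3 ≤ r) (h8 : r < 8) :
    pfWindow (2 * n + 2) m + (7 * n + 5) ≤ pfWindow (16 * n + 13) (8 * m + r) ∧
    pfWindow (16 * n + 13) (8 * m + r) ≤ pfWindow (2 * n + 2) m + (7 * n + 6) := by
  have e := pfOnes_add (8 * m + r) (16 * n + 13)
  have h := pfOnes_add m (2 * n + 2)
  obtain ⟨-, -, hm3, hm4, hm5, hm6, hm7⟩ := pfOnes_eight_mul_add m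
  obtain ⟨hk1, hk2, hk3, hk4, -, -, -⟩ := pfOnes_eight_mul_add (m + (2 * n + 2))
  have hk0 := pfOnes_eight_mul (m + (2 * n + 2))
  have hdiv : (m + (2 * n + 2)) / 2 = m / 2 + n + 1 := by omega
  have hmod : (m + (2 * n + 2)) % 2 = m % 2 := by omega
  have hlt : m % 2 < 2 := Nat.mod_lt _ (by norm_num)
  rw [show 8 * m + r + (16 * n + 13) = 8 * (m + (2 * n + 2)) + (r - 3) by omega] at e
  rw [hdiv] at hk0 hk1 hk2 hk3 hk4
  rw [hmod] at hk4
  generalize m / 2 = q at *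
  generalize m % 2 = s at *
  obtain rfl | rfl | rfl | rfl | rfl : r = 3 ∨ r = 4 ∨ r = 5 ∨ r = 6 ∨ r = 7 := by omega
  · rw [Nat.sub_self, add_zero, hk0, hm3, h] at e; omega
  · rw [hk1, hm4, h] at e; omega
  · rw [hk2, hm5, h] at e; omega
  · rw [hk3, hm6, h] at e; omega
  · rw [hk4, hm7, h] at e; omega

theorem pf_rho_sixteen_mul_add_thirteen : ∀ n : ℕ, ρ (16 * n + 13) = ρ (2 * n + 1) + 2 := by
  intro n
  obtain ⟨lo, hi, hle, hrange⟩ :=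
    range_eq_Icc_of_step_le_one (pfWindow_step (2 * n + 1)) (pfWindow_le (2 * n + 1))
  have hbound (m : ℕ) : lo ≤ pfWindow (2 * n + 1) m ∧ pfWindow (2 * n + 1) m ≤ hi :=
    Set.mem_Icc.1 (hrange ▸ Set.mem_range_self m)
  have hattain (z : ℕ) (h1 : lo ≤ z) (h2 : z ≤ hi) : ∃ m, pfWindow (2 * n + 1) m = z :=
    (hrange ▸ Set.mem_Icc.2 ⟨h1, h2⟩ : z ∈ Set.range (pfWindow (2 * n + 1)))
  have hrange' : Set.range (pfWindow (16 * n + 13)) =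
      Set.Icc (lo + (7 * n + 5)) (hi + (7 * n + 7)) := by
    apply Set.Subset.antisymm
    · rintro _ ⟨a, rfl⟩
      obtain ⟨m, r, hr, rfl⟩ : ∃ m r, r < 8 ∧ a = 8 * m + r :=
        ⟨a / 8, a % 8, by omega, by omega⟩
      have hb := hbound m
      rw [Set.mem_Icc]
      by_cases h3 : 3 ≤ r
      · have hw := pfWindow_eight_mul_add n m r h3 hr
        have hs : pfWindow (2 * n + 2) m = pfWindow (2 * n + 1) m + pf (m + 1 + (2 * n + 1)) :=
          Finset.sum_range_succ _ _
        have := pf_le_one (m + 1 + (2 * n + 1))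
        omega
      · have hw := pfWindow_eight_mul n m
        interval_cases r <;> (try simp only [add_zero]) <;> omega
    · rintro z ⟨h1, h2⟩
      by_cases hlow : z ≤ hi + (7 * n + 5)
      · obtain ⟨m, hm⟩ := hattain (z - (7 * n + 5)) (by omega) (by omega)
        exact ⟨8 * m, by rw [(pfWindow_eight_mul n m).1]; omega⟩
      by_cases hmid : z = hi + (7 * n + 6)
      · obtain ⟨m, hm⟩ := hattain hi hle le_rfl
        exact ⟨8 * m + 1, by rw [(pfWindow_eight_mul n m).2.1]; omega⟩
      · obtain ⟨m, hm⟩ := hattain hi hle le_rfl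
        exact ⟨8 * m + 2, by rw [(pfWindow_eight_mul n m).2.2]; omega⟩
  rw [rho_eq_ncard_range, rho_eq_ncard_range, hrange, hrange', Set.ncard_Icc_nat,
    Set.ncard_Icc_nat]
  omega
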